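/- arXiv:2111.09444 — 2 statements merged into one kernel-verified Lean document; each statement's English description precedes it below -/
import Mathlib

section
/- There is a universal constant C > 0 such that the following holds. Let (X,Π) be a two-sided γ-local-spectral expander and f ∈ C_k. Then for every i ≤ k: |⟨g_i, g_i⟩ − (1/C(k,i))·⟨f_i^↑, f_i^↑⟩| ≤ k^{Ci}·γ·‖D_i^k f‖₂². -/
open Finset

/-- Functions on faces of a complex on vertex set `Fin n`. -/
abbrev Cf (n : ℕ) := Finset (Fin n) → ℝ

/-- A `d`-dimensional weighted pure simplicial complex on vertex set `Fin n`:
the downward closure of a `d`-uniform hypergraph `faces d`, together with a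
probability distribution on the top faces inducing distributions `w i` on each
level `faces i` via `π_i(x) = (1/(i+1))·Σ_{y ⊃ x} π_{i+1}(y)`. -/
structure WSC (n d : ℕ) where
  faces : ℕ → Finset (Finset (Fin n))
  top_nonempty : (faces d).Nonempty
  card_mem : ∀ i, ∀ s ∈ faces i, s.card = i
  empty_levels : ∀ i, d < i → faces i = ∅
  downward : ∀ i, i < d → ∀ s : Finset (Fin n),
    s ∈ faces i ↔ (s.card = i ∧ ∃ t ∈ faces (i+1), s ⊆ t)
  w : ℕ → Finset (Fin n) → ℝ
  w_nonneg : ∀ i s, 0 ≤ w i s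
  w_pos : ∀ i, ∀ s ∈ faces i, 0 < w i s
  w_zero : ∀ i s, s ∉ faces i → w i s = 0
  w_top_sum : ∑ s ∈ faces d, w d s = 1
  w_rec : ∀ i, i < d → ∀ s ∈ faces i,
    w i s = (1/(i+1 : ℝ)) * ∑ t ∈ (faces (i+1)).filter (fun t => s ⊆ t), w (i+1) t

variable {n d : ℕ}

/-- The up operator `U_k : C_k → C_{k+1}`. -/
noncomputable def Uop (X : WSC n d) (k : ℕ) (f : Cf n) : Cf n := fun τ =>
  (1/(k+1 : ℝ)) * ∑ σ ∈ (X.faces k).filter (fun σ => σ ⊆ τ), f σ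

/-- The down operator `D_{k+1} : C_{k+1} → C_k`. -/
noncomputable def Dop (X : WSC n d) (k : ℕ) (f : Cf n) : Cf n := fun τ =>
  (∑ σ ∈ (X.faces (k+1)).filter (fun σ => τ ⊆ σ), X.w (k+1) σ * f σ) /
  (∑ σ ∈ (X.faces (k+1)).filter (fun σ => τ ⊆ σ), X.w (k+1) σ)

/-- `Uc X i m : C_i → C_{i+m}` is the iterated up operator; `U_i^k = Uc X i (k-i)`. -/
noncomputable def Uc (X : WSC n d) (i : ℕ) : ℕ → Cf n → Cf n
  | 0, f => f
  | m+1, f => Uop X (i+m) (Uc X i m f)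

/-- `Dc X k m : C_k → C_{k-m}` is the iterated down operator; `D_i^k = Dc X k (k-i)`. -/
noncomputable def Dc (X : WSC n d) (k : ℕ) : ℕ → Cf n → Cf n
  | 0, f => f
  | m+1, f => Dop X (k - (m+1)) (Dc X k m f)

/-- Bottom-Up level functions: `g_i = D_i^k f − Σ_{j<i} C(i,j)·U_j^i g_j ∈ C_i`. -/
noncomputable def gLevel (X : WSC n d) (k : ℕ) (f : Cf n) : ℕ → Cf n
  | i => Dc X k (k - i) f - ∑ j ∈ (Finset.range i).attach,
      ((i.choose j.1 : ℝ)) • Uc X j.1 (i - j.1) (gLevel X k f j.1)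
  termination_by i => i
  decreasing_by exact Finset.mem_range.mp j.2

/-- Lifted Bottom-Up level functions: `f_i^↑ = C(k,i)·U_i^k g_i ∈ C_k`. -/
noncomputable def fLevel (X : WSC n d) (k : ℕ) (f : Cf n) (i : ℕ) : Cf n :=
  ((k.choose i : ℝ)) • Uc X i (k - i) (gLevel X k f i)

/-- Inner product at level `i`: `⟨f,g⟩ = E_{τ∼π_i}[f(τ)g(τ)]`. -/
noncomputable def ip (X : WSC n d) (i : ℕ) (f g : Cf n) : ℝ :=
  ∑ τ ∈ X.faces i, X.w i τ * f τ * g τ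

/-- Expectation at level `i`. -/
noncomputable def EE (X : WSC n d) (i : ℕ) (f : Cf n) : ℝ :=
  ∑ τ ∈ X.faces i, X.w i τ * f τ

/-- `L²` norm at level `i`. -/
noncomputable def norm2 (X : WSC n d) (i : ℕ) (f : Cf n) : ℝ := Real.sqrt (ip X i f f)

/-- `L^p` norm at level `i`. -/
noncomputable def normP (X : WSC n d) (i : ℕ) (p : ℝ) (f : Cf n) : ℝ :=
  (∑ τ ∈ X.faces i, X.w i τ * |f τ| ^ p) ^ (1/p)

/-- `L^∞` norm at level `i` : the maximum of `|f|` over `i`-faces. -/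
noncomputable def normInf (X : WSC n d) (i : ℕ) (f : Cf n) : ℝ :=
  ⨆ τ : {σ // σ ∈ X.faces i}, |f τ.1|

/-- `E_{X_τ}[f|_τ]`: the weighted mean of `f ∈ C_k` over `k`-faces containing `τ`. -/
noncomputable def linkMean (X : WSC n d) (k : ℕ) (τ : Finset (Fin n)) (f : Cf n) : ℝ :=
  (∑ ρ ∈ (X.faces k).filter (fun ρ => τ ⊆ ρ), X.w k ρ * f ρ) /
  (∑ ρ ∈ (X.faces k).filter (fun ρ => τ ⊆ ρ), X.w k ρ)

/-- `⟨f|_τ, g|_τ⟩` over the link `X_τ` with its induced distribution, for `f, g ∈ C_k`. -/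
noncomputable def linkIp (X : WSC n d) (k : ℕ) (τ : Finset (Fin n)) (f g : Cf n) : ℝ :=
  (∑ ρ ∈ (X.faces k).filter (fun ρ => τ ⊆ ρ), X.w k ρ * f ρ * g ρ) /
  (∑ ρ ∈ (X.faces k).filter (fun ρ => τ ⊆ ρ), X.w k ρ)

/-- `f ∈ C_k` is `(ε,i)`-pseudorandom: `|E_{X_τ}[f|_τ]| ≤ ε‖f‖_∞` and
`⟨f|_τ,f|_τ⟩ ≤ ε‖f‖_∞²` for every `i`-face `τ`. -/
def Pseudorandom (X : WSC n d) (k : ℕ) (ε : ℝ) (i : ℕ) (f : Cf n) : Prop :=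
  ∀ τ ∈ X.faces i, |linkMean X k τ f| ≤ ε * normInf X k f ∧
    linkIp X k τ f f ≤ ε * (normInf X k f)^2

/-- Boolean ({0,1}-valued) function on `X(k)`. -/
def IsBool (X : WSC n d) (k : ℕ) (f : Cf n) : Prop := ∀ τ ∈ X.faces k, f τ = 0 ∨ f τ = 1

/-- Total influence `I[f] = ⟨f, k(Id − U_{k−1}D_k) f⟩`. -/
noncomputable def influence (X : WSC n d) (k : ℕ) (f : Cf n) : ℝ :=
  (k : ℝ) * (ip X k f f - ip X k f (Uop X (k-1) (Dop X (k-1) f)))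

/-- Variance `Var(f) = E[f²] − E[f]²`. -/
noncomputable def variance (X : WSC n d) (k : ℕ) (f : Cf n) : ℝ :=
  ip X k f f - (EE X k f)^2

/-- The noise operator `T_ρ = Σ_{i=0}^k C(k,i)(1−ρ)^i ρ^{k−i} U_{k−i}^k D_{k−i}^k`. -/
noncomputable def noiseOp (X : WSC n d) (k : ℕ) (ρ : ℝ) (f : Cf n) : Cf n :=
  ∑ i ∈ Finset.range (k+1),
    ((k.choose i : ℝ) * (1-ρ)^i * ρ^(k-i)) • Uc X (k-i) i (Dc X k i f)

/-- Noise stability `Stab_ρ(f) = ⟨f, T_ρ f⟩`. -/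
noncomputable def stab (X : WSC n d) (k : ℕ) (ρ : ℝ) (f : Cf n) : ℝ :=
  ip X k f (noiseOp X k ρ f)

/-- Edge weights of the underlying graph of the link of `s ∈ X(i)`. -/
noncomputable def edgeW (X : WSC n d) (i : ℕ) (s : Finset (Fin n)) (u v : Fin n) : ℝ :=
  if u ≠ v ∧ u ∉ s ∧ v ∉ s ∧ insert u (insert v s) ∈ X.faces (i+2)
  then X.w (i+2) (insert u (insert v s)) else 0

/-- Vertex weights of the underlying graph of the link of `s ∈ X(i)`. -/
noncomputable def vertW (X : WSC n d) (i : ℕ) (s : Finset (Fin n)) (u : Fin n) : ℝ :=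
  ∑ v, edgeW X i s u v

/-- `X` is a two-sided `γ`-local-spectral expander: for every `i ≤ d−2` and every
`s ∈ X(i)` (including `s = ∅`), every nontrivial eigenvalue of the weighted adjacency
operator of the graph `(X_s(1), X_s(2))` has absolute value at most `γ`, expressed via
the quadratic form on functions orthogonal to constants. -/
def IsLSE (X : WSC n d) (γ : ℝ) : Prop :=
  ∀ i, i + 2 ≤ d → ∀ s ∈ X.faces i, ∀ f : Fin n → ℝ,
    (∑ u, vertW X i s u * f u) = 0 →
    |∑ u, ∑ v, edgeW X i s u v * f u * f v| ≤ γ * ∑ u, vertW X i s u * (f u)^2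

/-- The swap walk `S_{j,i} : C_i → C_j`: `(S_{j,i} f)(τ)` is the weighted mean of `f(σ)`
over `i`-faces `σ` disjoint from `τ` with `τ ∪ σ ∈ X(i+j)`. -/
noncomputable def swapW (X : WSC n d) (j i : ℕ) (f : Cf n) : Cf n := fun τ =>
  (∑ σ ∈ (X.faces i).filter (fun σ => Disjoint σ τ ∧ σ ∪ τ ∈ X.faces (i+j)),
      X.w (i+j) (σ ∪ τ) * f σ) /
  (∑ σ ∈ (X.faces i).filter (fun σ => Disjoint σ τ ∧ σ ∪ τ ∈ X.faces (i+j)),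
      X.w (i+j) (σ ∪ τ))

/-- Localized mean: `E_{σ ∼ π_{v,i}}[f(σ)]`, the mean of `f ∈ C_i` over the `i`-faces of
the link `X_v` of `v ∈ X(j)`, with respect to the distribution induced by the link. -/
noncomputable def locMean (X : WSC n d) (i j : ℕ) (v : Finset (Fin n)) (f : Cf n) : ℝ :=
  (∑ σ ∈ (X.faces i).filter (fun σ => Disjoint σ v ∧ σ ∪ v ∈ X.faces (i+j)),
      X.w (i+j) (σ ∪ v) * f σ) /
  (∑ σ ∈ (X.faces i).filter (fun σ => Disjoint σ v ∧ σ ∪ v ∈ X.faces (i+j)),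
      X.w (i+j) (σ ∪ v))

/-- The `m`-faces of the link `X_τ`. -/
noncomputable def lkFaces (X : WSC n d) (τ : Finset (Fin n)) (m : ℕ) : Finset (Finset (Fin n)) :=
  (Finset.univ : Finset (Finset (Fin n))).filter
    (fun σ => Disjoint σ τ ∧ σ ∪ τ ∈ X.faces (τ.card + m))

/-- Inner product at level `m` of the link `X_τ` (with the induced distribution). -/
noncomputable def lkIp (X : WSC n d) (τ : Finset (Fin n)) (m : ℕ) (f g : Cf n) : ℝ :=
  (∑ σ ∈ lkFaces X τ m, X.w (τ.card + m) (σ ∪ τ) * f σ * g σ) /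
  (∑ σ ∈ lkFaces X τ m, X.w (τ.card + m) (σ ∪ τ))

/-- `L²` norm at level `m` of the link `X_τ`. -/
noncomputable def lkNorm2 (X : WSC n d) (τ : Finset (Fin n)) (m : ℕ) (f : Cf n) : ℝ :=
  Real.sqrt (lkIp X τ m f f)

/-- Global mean at level `m` of the link `X_τ` (the stationary operator `U_0^j D_0^m`
of the swap walk on `X_τ` applied to `f`). -/
noncomputable def lkMeanLvl (X : WSC n d) (τ : Finset (Fin n)) (m : ℕ) (f : Cf n) : ℝ :=
  (∑ σ ∈ lkFaces X τ m, X.w (τ.card + m) (σ ∪ τ) * f σ) /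
  (∑ σ ∈ lkFaces X τ m, X.w (τ.card + m) (σ ∪ τ))

/-- The swap walk `S_{j,m}` within the link `X_τ`. -/
noncomputable def lkSwap (X : WSC n d) (τ : Finset (Fin n)) (j m : ℕ) (f : Cf n) : Cf n := fun v =>
  (∑ σ ∈ (lkFaces X τ m).filter (fun σ => Disjoint σ v ∧ σ ∪ v ∈ lkFaces X τ (m+j)),
      X.w (τ.card + m + j) (σ ∪ v ∪ τ) * f σ) /
  (∑ σ ∈ (lkFaces X τ m).filter (fun σ => Disjoint σ v ∧ σ ∪ v ∈ lkFaces X τ (m+j)),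
      X.w (τ.card + m + j) (σ ∪ v ∪ τ))

/-- Restriction `f|_τ(σ) = f(τ ∪ σ)`. -/
def restrictF (τ : Finset (Fin n)) (f : Cf n) : Cf n := fun σ => f (τ ∪ σ)

/-- The Bottom-Up level function of the restriction `f|_υ` computed within the link
`X_υ` (via its explicit form): `g_ℓ^{(υ)}(I) = Σ_{T ⊆ I} (−1)^{|I∖T|}·E_{(X_υ)_T}[f|_υ]`. -/
noncomputable def gLink (X : WSC n d) (k : ℕ) (f : Cf n) (υ : Finset (Fin n)) : Cf n :=
  fun I => ∑ σ ∈ I.powerset, (-1:ℝ)^((I \ σ).card) * linkMean X k (υ ∪ σ) f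

/-! ### The level norms as Euclidean norms -/

/-- The weighted embedding of functions on faces into a Euclidean space which turns `ip X i` into
the standard inner product. -/
noncomputable def levelEmb (X : WSC n d) (i : ℕ) :
    Cf n →ₗ[ℝ] EuclideanSpace ℝ (Finset (Fin n)) where
  toFun f := WithLp.toLp 2 fun τ => Real.sqrt (X.w i τ) * f τ
  map_add' f g := by ext τ; simp [mul_add]
  map_smul' c f := by ext τ; simp [mul_left_comm]

theorem ip_eq_sum_univ (X : WSC n d) (i : ℕ) (f g : Cf n) :
    ip X i f g = ∑ τ, X.w i τ * f τ * g τ := by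
  refine sum_subset (subset_univ _) fun τ _ h => ?_
  simp [X.w_zero i τ h]

theorem ip_eq_inner (X : WSC n d) (i : ℕ) (f g : Cf n) :
    ip X i f g = inner ℝ (levelEmb X i f) (levelEmb X i g) := by
  rw [ip_eq_sum_univ]
  simp only [levelEmb, LinearMap.coe_mk, AddHom.coe_mk, PiLp.inner_apply, RCLike.inner_apply,
    conj_trivial]
  refine sum_congr rfl fun τ _ => ?_
  linear_combination (-(f τ * g τ)) * Real.mul_self_sqrt (X.w_nonneg i τ)

theorem norm2_eq_norm (X : WSC n d) (i : ℕ) (f : Cf n) : norm2 X i f = ‖levelEmb X i f‖ := by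
  rw [norm2, ip_eq_inner, real_inner_self_eq_norm_sq, Real.sqrt_sq (norm_nonneg _)]

theorem ip_self (X : WSC n d) (i : ℕ) (f : Cf n) : ip X i f f = norm2 X i f ^ 2 := by
  rw [norm2_eq_norm, ip_eq_inner, real_inner_self_eq_norm_sq]

theorem norm2_nonneg (X : WSC n d) (i : ℕ) (f : Cf n) : 0 ≤ norm2 X i f := Real.sqrt_nonneg _

theorem norm2_add_le (X : WSC n d) (i : ℕ) (f g : Cf n) :
    norm2 X i (f + g) ≤ norm2 X i f + norm2 X i g := by
  simpa only [norm2_eq_norm, map_add] using norm_add_le _ _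

theorem norm2_sub_le (X : WSC n d) (i : ℕ) (f g : Cf n) :
    norm2 X i (f - g) ≤ norm2 X i f + norm2 X i g := by
  simpa only [norm2_eq_norm, map_sub] using norm_sub_le _ _

theorem norm2_neg (X : WSC n d) (i : ℕ) (f : Cf n) : norm2 X i (-f) = norm2 X i f := by
  simp only [norm2_eq_norm, map_neg, norm_neg]

theorem norm2_sum_le {ι : Type*} (X : WSC n d) (i : ℕ) (s : Finset ι) (F : ι → Cf n) :
    norm2 X i (∑ j ∈ s, F j) ≤ ∑ j ∈ s, norm2 X i (F j) := by
  simpa only [norm2_eq_norm, map_sum] using norm_sum_le _ _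

theorem norm2_smul (X : WSC n d) (i : ℕ) {c : ℝ} (hc : 0 ≤ c) (f : Cf n) :
    norm2 X i (c • f) = c * norm2 X i f := by
  simp only [norm2_eq_norm, map_smul, norm_smul, Real.norm_of_nonneg hc]

theorem abs_ip_le (X : WSC n d) (i : ℕ) (f g : Cf n) :
    |ip X i f g| ≤ norm2 X i f * norm2 X i g := by
  simpa only [norm2_eq_norm, ip_eq_inner] using abs_real_inner_le_norm _ _

theorem ip_comm (X : WSC n d) (i : ℕ) (f g : Cf n) : ip X i f g = ip X i g f := by
  simp only [ip_eq_inner, real_inner_comm]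

theorem ip_add_right (X : WSC n d) (i : ℕ) (f g h : Cf n) :
    ip X i f (g + h) = ip X i f g + ip X i f h := by
  simp only [ip_eq_inner, map_add, inner_add_right]

theorem ip_add_left (X : WSC n d) (i : ℕ) (f g h : Cf n) :
    ip X i (f + g) h = ip X i f h + ip X i g h := by
  simp only [ip_eq_inner, map_add, inner_add_left]

theorem ip_sub_right (X : WSC n d) (i : ℕ) (f g h : Cf n) :
    ip X i f (g - h) = ip X i f g - ip X i f h := by
  simp only [ip_eq_inner, map_sub, inner_sub_right]

theorem ip_smul_right (X : WSC n d) (i : ℕ) (c : ℝ) (f g : Cf n) :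
    ip X i f (c • g) = c * ip X i f g := by
  simp only [ip_eq_inner, map_smul, real_inner_smul_right]

theorem ip_smul_left (X : WSC n d) (i : ℕ) (c : ℝ) (f g : Cf n) :
    ip X i (c • f) g = c * ip X i f g := by
  simp only [ip_eq_inner, map_smul, real_inner_smul_left]

/-! ### Linearity of the up and down operators -/

/-- The up operator as a linear map. -/
noncomputable def upLin (X : WSC n d) (k : ℕ) : Cf n →ₗ[ℝ] Cf n where
  toFun := Uop X k
  map_add' f g := by ext τ; simp [Uop, sum_add_distrib, mul_add]
  map_smul' c f := by ext τ; simp [Uop, ← mul_sum, mul_left_comm]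

/-- The down operator as a linear map. -/
noncomputable def downLin (X : WSC n d) (k : ℕ) : Cf n →ₗ[ℝ] Cf n where
  toFun := Dop X k
  map_add' f g := by ext τ; simp [Dop, sum_add_distrib, mul_add, add_div]
  map_smul' c f := by ext τ; simp [Dop, mul_left_comm _ c, ← mul_sum, mul_div_assoc]

theorem upLin_apply (X : WSC n d) (k : ℕ) (f : Cf n) : upLin X k f = Uop X k f := rfl

theorem downLin_apply (X : WSC n d) (k : ℕ) (f : Cf n) : downLin X k f = Dop X k f := rfl

/-! ### Double counting of faces and facets -/

theorem sum_compl_insert_eq_sum_erase (G : Finset (Fin n) → Fin n → ℝ) :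
    ∑ s, ∑ a ∈ sᶜ, G s a = ∑ t : Finset (Fin n), ∑ a ∈ t, G (t.erase a) a := by
  rw [sum_sigma', sum_sigma']
  refine sum_bij' (fun p _ => ⟨insert p.2 p.1, p.2⟩) (fun p _ => ⟨p.1.erase p.2, p.2⟩) ?_ ?_ ?_ ?_ ?_
  · rintro ⟨s, a⟩ h; simp
  · rintro ⟨s, a⟩ h; simp
  · rintro ⟨s, a⟩ h
    have : a ∉ s := by simpa using h
    simp [erase_insert this]
  · rintro ⟨s, a⟩ h
    have : a ∈ s := by simpa using h
    simp [insert_erase this]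
  · rintro ⟨s, a⟩ h
    have : a ∉ s := by simpa using h
    simp [erase_insert this]

theorem WSC.mem_faces_of_insert (X : WSC n d) {l : ℕ} (hl : l < d) {s : Finset (Fin n)} {a : Fin n}
    (ha : a ∉ s) (h : insert a s ∈ X.faces (l + 1)) : s ∈ X.faces l := by
  refine (X.downward l hl s).2 ⟨?_, _, h, subset_insert _ _⟩
  have := X.card_mem _ _ h
  rw [card_insert_of_notMem ha] at this
  omega

theorem WSC.erase_mem_faces (X : WSC n d) {l : ℕ} (hl : l < d) {t : Finset (Fin n)} {a : Fin n}
    (ha : a ∈ t) (h : t ∈ X.faces (l + 1)) : t.erase a ∈ X.faces l :=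
  X.mem_faces_of_insert hl (notMem_erase a t) (by rwa [insert_erase ha])

theorem WSC.sum_superfaces (X : WSC n d) {l : ℕ} {s : Finset (Fin n)} (hs : s.card = l)
    (F : Cf n) :
    ∑ t ∈ (X.faces (l + 1)).filter (fun t => s ⊆ t), X.w (l + 1) t * F t =
      ∑ a ∈ sᶜ, X.w (l + 1) (insert a s) * F (insert a s) := by
  symm
  have hinj : Set.InjOn (fun a => insert a s) (sᶜ : Finset (Fin n)) := by
    intro a ha b _ hab
    have ha' : a ∉ s := by simpa using ha
    have : a ∈ insert b s := by rw [← show insert a s = insert b s from hab]; simp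
    simpa [ha'] using this
  rw [← sum_image (f := fun t => X.w (l + 1) t * F t) hinj]
  symm
  refine sum_subset ?_ ?_
  · intro t ht
    obtain ⟨ht, hst⟩ := mem_filter.1 ht
    have h1 := X.card_mem _ _ ht
    obtain ⟨a, ha⟩ := card_eq_one.1 (show (t \ s).card = 1 by rw [card_sdiff_of_subset hst]; omega)
    refine mem_image.2 ⟨a, ?_, ?_⟩
    · have : a ∈ t \ s := by simp [ha]
      simpa using (mem_sdiff.1 this).2
    · rw [insert_eq, ← ha, sdiff_union_of_subset hst]
  · intro t ht hnt
    obtain ⟨a, _, rfl⟩ := mem_image.1 ht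
    have : insert a s ∉ X.faces (l + 1) := fun h => hnt (mem_filter.2 ⟨h, subset_insert _ _⟩)
    simp [X.w_zero _ _ this]

theorem WSC.sum_w_insert (X : WSC n d) {l : ℕ} (hl : l < d) (s : Finset (Fin n)) :
    ∑ a ∈ sᶜ, X.w (l + 1) (insert a s) = (l + 1) * X.w l s := by
  by_cases hs : s ∈ X.faces l
  · have h := X.sum_superfaces (X.card_mem _ _ hs) (fun _ => 1)
    simp only [mul_one] at h
    rw [X.w_rec l hl s hs, ← h]
    field_simp
  · rw [X.w_zero _ _ hs, mul_zero]
    refine sum_eq_zero fun a ha => X.w_zero _ _ fun h => hs ?_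
    exact X.mem_faces_of_insert hl (by simpa using ha) h

theorem sum_w_mul_sum_erase (X : WSC n d) {l : ℕ} (hl : l < d) (F : Cf n) :
    ∑ t, X.w (l + 1) t * ∑ a ∈ t, F (t.erase a) = (l + 1) * ∑ s, X.w l s * F s := by
  have h := sum_compl_insert_eq_sum_erase fun s a => X.w (l + 1) (insert a s) * F s
  simp only [← sum_mul, X.sum_w_insert hl] at h
  rw [mul_sum]
  simp only [← mul_assoc]
  rw [h]
  refine sum_congr rfl fun t _ => ?_
  rw [mul_sum]
  exact sum_congr rfl fun a ha => by rw [insert_erase ha]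

theorem Uop_apply_face (X : WSC n d) {l : ℕ} (hl : l < d) (f : Cf n) {t : Finset (Fin n)}
    (ht : t ∈ X.faces (l + 1)) : (l + 1 : ℝ) * Uop X l f t = ∑ a ∈ t, f (t.erase a) := by
  have hinj : Set.InjOn (fun a => t.erase a) t := fun a ha b hb hab => by
    by_contra hne
    have : a ∈ t.erase b := mem_erase.2 ⟨hne, ha⟩
    rw [← show t.erase a = t.erase b from hab] at this
    simp at this
  have : (X.faces l).filter (fun σ => σ ⊆ t) = t.image fun a => t.erase a := by
    ext σ
    simp only [mem_filter, mem_image]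
    constructor
    · rintro ⟨h1, h2⟩
      have hc := X.card_mem _ _ h1
      have hc' := X.card_mem _ _ ht
      obtain ⟨a, ha⟩ := card_eq_one.1 (show (t \ σ).card = 1 by rw [card_sdiff_of_subset h2]; omega)
      have hat : a ∈ t \ σ := by simp [ha]
      exact ⟨a, (mem_sdiff.1 hat).1, by rw [erase_eq, ← ha, Finset.sdiff_sdiff_eq_self h2]⟩
    · rintro ⟨a, ha, rfl⟩
      exact ⟨X.erase_mem_faces hl ha ht, erase_subset _ _⟩
  rw [Uop, this, sum_image hinj]
  field_simp

theorem w_mul_Uop (X : WSC n d) {l : ℕ} (hl : l < d) (f : Cf n) (t : Finset (Fin n)) :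
    (l + 1 : ℝ) * (X.w (l + 1) t * Uop X l f t) = X.w (l + 1) t * ∑ a ∈ t, f (t.erase a) := by
  by_cases ht : t ∈ X.faces (l + 1)
  · rw [← Uop_apply_face X hl f ht]; ring
  · simp [X.w_zero _ _ ht]

theorem w_mul_Dop (X : WSC n d) {l : ℕ} (hl : l < d) (f : Cf n) (s : Finset (Fin n)) :
    (l + 1 : ℝ) * (X.w l s * Dop X l f s) =
      ∑ a ∈ sᶜ, X.w (l + 1) (insert a s) * f (insert a s) := by
  by_cases hs : s ∈ X.faces l
  · have h := X.sum_superfaces (X.card_mem _ _ hs) (fun _ => 1)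
    simp only [mul_one, X.sum_w_insert hl] at h
    have hw := X.w_pos _ _ hs
    rw [Dop, h, X.sum_superfaces (X.card_mem _ _ hs)]
    field_simp
  · rw [X.w_zero _ _ hs]
    symm
    rw [zero_mul, mul_zero]
    refine sum_eq_zero fun a ha => ?_
    rw [X.w_zero _ _ fun h => hs (X.mem_faces_of_insert hl (by simpa using ha) h), zero_mul]

theorem ip_Uop_left (X : WSC n d) {l : ℕ} (hl : l < d) (f g : Cf n) :
    ip X (l + 1) (Uop X l f) g = ip X l f (Dop X l g) := by
  have h := sum_compl_insert_eq_sum_erase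
    fun s a => X.w (l + 1) (insert a s) * g (insert a s) * f s
  have h0 : (l + 1 : ℝ) ≠ 0 := by positivity
  apply mul_left_cancel₀ h0
  rw [ip_eq_sum_univ, ip_eq_sum_univ, mul_sum, mul_sum]
  calc _ = ∑ t : Finset (Fin n), ∑ a ∈ t,
        X.w (l + 1) (insert a (t.erase a)) * g (insert a (t.erase a)) * f (t.erase a) := by
        refine sum_congr rfl fun t _ => ?_
        rw [← mul_assoc, w_mul_Uop X hl, mul_sum, sum_mul]
        exact sum_congr rfl fun a ha => by rw [insert_erase ha]; ring
    _ = _ := by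
        rw [← h]
        refine sum_congr rfl fun s _ => ?_
        rw [← sum_mul, ← w_mul_Dop X hl]
        ring

theorem norm2_Uop_le (X : WSC n d) {l : ℕ} (hl : l < d) (f : Cf n) :
    norm2 X (l + 1) (Uop X l f) ≤ norm2 X l f := by
  refine Real.sqrt_le_sqrt ?_
  have h0 : (0 : ℝ) < l + 1 := by positivity
  have hpt : ∀ t, (l + 1 : ℝ) * (X.w (l + 1) t * Uop X l f t * Uop X l f t) ≤
      X.w (l + 1) t * ∑ a ∈ t, f (t.erase a) ^ 2 := by
    intro t
    by_cases ht : t ∈ X.faces (l + 1)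
    · have hcs := sq_sum_le_card_mul_sum_sq (s := t) (f := fun a => f (t.erase a))
      rw [← Uop_apply_face X hl f ht, X.card_mem _ _ ht] at hcs
      push_cast at hcs
      have : (l + 1 : ℝ) * Uop X l f t ^ 2 ≤ ∑ a ∈ t, f (t.erase a) ^ 2 := by
        refine le_of_mul_le_mul_left ?_ h0
        linarith
      nlinarith [mul_le_mul_of_nonneg_left this (X.w_nonneg (l + 1) t)]
    · simp [X.w_zero _ _ ht]
  refine le_of_mul_le_mul_left ?_ h0
  rw [ip_eq_sum_univ, ip_eq_sum_univ, mul_sum]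
  refine (sum_le_sum fun t _ => hpt t).trans_eq ?_
  rw [sum_w_mul_sum_erase X hl fun s => f s ^ 2]
  simp only [sq, mul_assoc]

theorem norm2_Dop_le (X : WSC n d) {l : ℕ} (hl : l < d) (f : Cf n) :
    norm2 X l (Dop X l f) ≤ norm2 X (l + 1) f := by
  have h1 : norm2 X l (Dop X l f) ^ 2 ≤ norm2 X l (Dop X l f) * norm2 X (l + 1) f := by
    rw [← ip_self, ← ip_Uop_left X hl]
    refine (le_abs_self _).trans ((abs_ip_le _ _ _ _).trans ?_)
    exact mul_le_mul_of_nonneg_right (norm2_Uop_le X hl _) (norm2_nonneg _ _ _)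
  have h2 := norm2_nonneg X l (Dop X l f)
  have h3 := norm2_nonneg X (l + 1) f
  nlinarith

theorem norm2_Uc_le (X : WSC n d) (i : ℕ) (f : Cf n) :
    ∀ m, i + m ≤ d → norm2 X (i + m) (Uc X i m f) ≤ norm2 X i f
  | 0, _ => le_rfl
  | m + 1, h => (norm2_Uop_le X (l := i + m) (by omega) _).trans (norm2_Uc_le X i f m (by omega))

/-! ### The local-to-global estimate for `D U - U D` -/

theorem edgeW_symm (X : WSC n d) (l : ℕ) (s : Finset (Fin n)) (u v : Fin n) :
    edgeW X l s u v = edgeW X l s v u := by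
  unfold edgeW
  rw [insert_comm u v s]
  exact if_congr (by tauto) rfl rfl

theorem edgeW_of_mem (X : WSC n d) (l : ℕ) {s : Finset (Fin n)} {u : Fin n} (hu : u ∈ s)
    (v : Fin n) : edgeW X l s u v = 0 := if_neg fun h => h.2.1 hu

theorem sum_edgeW_mul (X : WSC n d) (l : ℕ) {s : Finset (Fin n)} {u : Fin n} (hu : u ∉ s)
    (G : Fin n → ℝ) :
    ∑ v, edgeW X l s u v * G v =
      ∑ v ∈ (insert u s)ᶜ, X.w (l + 2) (insert v (insert u s)) * G v := by
  symm
  refine sum_subset_zero_on_sdiff (subset_univ _) (fun v hv => ?_) fun v hv => ?_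
  · have hv' : v = u ∨ v ∈ s := by simpa [or_iff_not_imp_left] using hv
    have : edgeW X l s u v = 0 := if_neg fun h => hv'.elim (fun e => h.1 e.symm) h.2.2.1
    rw [this, zero_mul]
  · have hv' : ¬ (v = u ∨ v ∈ s) := by simpa using hv
    push Not at hv'
    have : edgeW X l s u v = X.w (l + 2) (insert v (insert u s)) := by
      unfold edgeW
      rw [insert_comm u v s]
      split_ifs with h
      · rfl
      · exact (X.w_zero _ _ fun h' => h ⟨hv'.1.symm, hu, hv'.2, h'⟩).symm
    rw [this]

theorem vertW_eq (X : WSC n d) {l : ℕ} (hl : l + 2 ≤ d) {s : Finset (Fin n)} {u : Fin n}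
    (hu : u ∉ s) : vertW X l s u = (l + 2) * X.w (l + 1) (insert u s) := by
  have h := sum_edgeW_mul X l hu fun _ => 1
  simp only [mul_one] at h
  rw [vertW, h, X.sum_w_insert (by omega)]
  push_cast
  ring

theorem sum_vertW_mul (X : WSC n d) {l : ℕ} (hl : l + 2 ≤ d) (s : Finset (Fin n))
    (G : Fin n → ℝ) :
    ∑ u, vertW X l s u * G u = (l + 2) * ∑ u ∈ sᶜ, X.w (l + 1) (insert u s) * G u := by
  rw [mul_sum]
  symm
  refine sum_subset_zero_on_sdiff (subset_univ _) (fun u hu => ?_) fun u hu => ?_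
  · have : u ∈ s := by simpa using hu
    simp [vertW, edgeW_of_mem X l this]
  · rw [vertW_eq X hl (by simpa using hu)]
    ring

theorem IsLSE.link_estimate {X : WSC n d} {γ : ℝ} (hγ : 0 ≤ γ) (hX : IsLSE X γ) {l : ℕ}
    (hl : l + 2 ≤ d) (h : Cf n) (s : Finset (Fin n)) :
    |(∑ u ∈ sᶜ, ∑ v ∈ (insert u s)ᶜ, X.w (l + 2) (insert v (insert u s)) *
        (h (insert u s) * h (insert v s))) -
      (l + 2) * (l + 1) * (X.w l s * Dop X l h s * Dop X l h s)| ≤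
      γ * ((l + 2) * ∑ u ∈ sᶜ, X.w (l + 1) (insert u s) * h (insert u s) ^ 2) := by
  by_cases hs : s ∈ X.faces l
  swap
  · have hz : ∀ u ∈ sᶜ, X.w (l + 1) (insert u s) = 0 := fun u hu =>
      X.w_zero _ _ fun hf => hs (X.mem_faces_of_insert (by omega) (by simpa using hu) hf)
    have h1 : ∑ u ∈ sᶜ, X.w (l + 1) (insert u s) * h (insert u s) ^ 2 = 0 :=
      sum_eq_zero fun u hu => by rw [hz u hu, zero_mul]
    have h2 : (∑ u ∈ sᶜ, ∑ v ∈ (insert u s)ᶜ, X.w (l + 2) (insert v (insert u s)) *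
        (h (insert u s) * h (insert v s))) = 0 := by
      refine sum_eq_zero fun u hu => sum_eq_zero fun v hv => ?_
      rw [X.w_zero _ _ fun hf => hs ?_, zero_mul]
      exact X.mem_faces_of_insert (by omega) (by simpa using hu)
        (X.mem_faces_of_insert (l := l + 1) (by omega) (by simpa using hv) hf)
    rw [h1, h2, X.w_zero _ _ hs]
    simp
  set c := Dop X l h s with hc
  set p : Fin n → ℝ := fun u => h (insert u s) with hp
  have hS1 : ∑ u, vertW X l s u * p u = (l + 2) * (l + 1) * X.w l s * c := by
    rw [sum_vertW_mul X hl, hp, ← w_mul_Dop X (by omega)]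
    ring
  have hS0 : ∑ u, vertW X l s u = (l + 2) * (l + 1) * X.w l s := by
    have := sum_vertW_mul X hl s fun _ => 1
    simp only [mul_one] at this
    rw [this, X.sum_w_insert (by omega)]
    ring
  have hS2 : ∑ u, vertW X l s u * p u ^ 2 =
      (l + 2) * ∑ u ∈ sᶜ, X.w (l + 1) (insert u s) * h (insert u s) ^ 2 := sum_vertW_mul X hl s _
  have hE : ∑ u, ∑ v, edgeW X l s u v * p u * p v =
      ∑ u ∈ sᶜ, ∑ v ∈ (insert u s)ᶜ, X.w (l + 2) (insert v (insert u s)) *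
        (h (insert u s) * h (insert v s)) := by
    symm
    refine sum_subset_zero_on_sdiff (subset_univ _) (fun u hu => ?_) fun u hu => ?_
    · have : u ∈ s := by simpa using hu
      simp [edgeW_of_mem X l this]
    · simp only [mul_assoc]
      exact (sum_edgeW_mul X l (by simpa using hu) fun v => p u * p v).symm
  have hrow : ∑ u, ∑ v, edgeW X l s u v * p u = (l + 2) * (l + 1) * X.w l s * c := by
    rw [← hS1]
    exact sum_congr rfl fun u _ => by rw [vertW, sum_mul]
  have hcol : ∑ u, ∑ v, edgeW X l s u v * p v = (l + 2) * (l + 1) * X.w l s * c := by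
    rw [sum_comm, ← hrow]
    exact sum_congr rfl fun u _ => sum_congr rfl fun v _ => by rw [edgeW_symm]
  have hall : ∑ u, ∑ v, edgeW X l s u v = (l + 2) * (l + 1) * X.w l s := hS0
  have key := hX l hl s hs (fun u => p u - c) (by
    simp only [mul_sub, sum_sub_distrib, ← sum_mul, hS0, hS1]
    ring)
  have e1 : ∑ u, ∑ v, edgeW X l s u v * (p u - c) * (p v - c) =
      (∑ u, ∑ v, edgeW X l s u v * p u * p v) - (l + 2) * (l + 1) * (X.w l s * c * c) := by
    have : ∀ u v, edgeW X l s u v * (p u - c) * (p v - c) =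
        edgeW X l s u v * p u * p v - c * (edgeW X l s u v * p u) -
          c * (edgeW X l s u v * p v) + c * c * edgeW X l s u v := fun u v => by ring
    simp only [this, sum_add_distrib, sum_sub_distrib, ← mul_sum, hrow, hcol, hall]
    ring
  have e2 : ∑ u, vertW X l s u * (p u - c) ^ 2 =
      (∑ u, vertW X l s u * p u ^ 2) - (l + 2) * (l + 1) * X.w l s * c ^ 2 := by
    have : ∀ u, vertW X l s u * (p u - c) ^ 2 = vertW X l s u * p u ^ 2 -
        2 * c * (vertW X l s u * p u) + c ^ 2 * vertW X l s u := fun u => by ring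
    simp only [this, sum_add_distrib, sum_sub_distrib, ← mul_sum, hS0, hS1]
    ring
  rw [e1, e2, hE, hS2] at key
  refine key.trans (mul_le_mul_of_nonneg_left (sub_le_self _ ?_) hγ)
  have := X.w_nonneg l s
  positivity

theorem sum_pairs_eq (X : WSC n d) {l : ℕ} (hl : l + 2 ≤ d) (h : Cf n) :
    ∑ s, ∑ u ∈ sᶜ, ∑ v ∈ (insert u s)ᶜ, X.w (l + 2) (insert v (insert u s)) *
        (h (insert u s) * h (insert v s)) =
      (l + 2) ^ 2 * ip X (l + 2) (Uop X (l + 1) h) (Uop X (l + 1) h) -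
        (l + 2) * ip X (l + 1) h h := by
  have step1 := sum_compl_insert_eq_sum_erase fun s u => ∑ v ∈ (insert u s)ᶜ,
    X.w (l + 2) (insert v (insert u s)) * (h (insert u s) * h (insert v s))
  have step2 := sum_compl_insert_eq_sum_erase fun r v => ∑ u ∈ r,
    X.w (l + 2) (insert v r) * (h r * h (insert v (r.erase u)))
  have hU : ∀ t, (l + 2 : ℝ) ^ 2 * (X.w (l + 2) t * Uop X (l + 1) h t * Uop X (l + 1) h t) =
      X.w (l + 2) t * (∑ a ∈ t, h (t.erase a)) ^ 2 := by
    intro t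
    by_cases ht : t ∈ X.faces (l + 2)
    · have := Uop_apply_face X (l := l + 1) (by omega) h ht
      rw [← this]
      push_cast
      ring
    · simp [X.w_zero _ _ ht]
  have hnorm := sum_w_mul_sum_erase X (l := l + 1) (by omega) fun s => h s ^ 2
  have hip : ip X (l + 1) h h = ∑ s, X.w (l + 1) s * h s ^ 2 := by
    rw [ip_eq_sum_univ]
    simp only [sq, mul_assoc]
  rw [← hip, show ((l + 1 : ℕ) : ℝ) + 1 = l + 2 by push_cast; ring] at hnorm
  rw [step1, ← hnorm, ip_eq_sum_univ, mul_sum, ← sum_sub_distrib]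
  simp only [hU]
  calc _ = ∑ r : Finset (Fin n), ∑ v ∈ rᶜ, ∑ u ∈ r,
        X.w (l + 2) (insert v r) * (h r * h (insert v (r.erase u))) := by
        refine sum_congr rfl fun r _ => ?_
        rw [sum_comm]
        refine sum_congr rfl fun u hu => ?_
        rw [insert_erase hu]
    _ = _ := by
        rw [step2]
        refine sum_congr rfl fun t _ => ?_
        rw [sq, sum_mul, ← mul_sub, ← sum_sub_distrib, mul_sum]
        refine sum_congr rfl fun v hv => ?_
        have hsplit := sum_erase_add t (fun u => h (t.erase u)) hv
        rw [← hsplit, insert_erase hv, mul_add, sq, add_sub_cancel_right, mul_sum, mul_sum]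
        refine sum_congr rfl fun u hu => ?_
        obtain ⟨hne, hut⟩ := mem_erase.1 hu
        rw [erase_right_comm, insert_erase (mem_erase.2 ⟨hne.symm, hv⟩)]

theorem IsLSE.abs_quadratic_le {X : WSC n d} {γ : ℝ} (hγ : 0 ≤ γ) (hX : IsLSE X γ) {l : ℕ}
    (hl : l + 2 ≤ d) (h : Cf n) :
    |ip X (l + 2) (Uop X (l + 1) h) (Uop X (l + 1) h) - 1 / (l + 2) * ip X (l + 1) h h -
      (l + 1) / (l + 2) * ip X l (Dop X l h) (Dop X l h)| ≤ γ * ip X (l + 1) h h := by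
  have hnorm : ∑ s, ∑ u ∈ sᶜ, X.w (l + 1) (insert u s) * h (insert u s) ^ 2 =
      (l + 1) * ip X (l + 1) h h := by
    rw [sum_compl_insert_eq_sum_erase
      fun s u => X.w (l + 1) (insert u s) * h (insert u s) ^ 2, ip_eq_sum_univ, mul_sum]
    refine sum_congr rfl fun t _ => ?_
    by_cases ht : t ∈ X.faces (l + 1)
    · rw [sum_congr rfl fun a ha => by rw [insert_erase ha], sum_const, X.card_mem _ _ ht,
        nsmul_eq_mul]
      push_cast
      ring
    · rw [sum_congr rfl fun a ha => by rw [insert_erase ha]]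
      simp [X.w_zero _ _ ht]
  have key : |((l + 2 : ℝ) ^ 2 * ip X (l + 2) (Uop X (l + 1) h) (Uop X (l + 1) h) -
      (l + 2) * ip X (l + 1) h h) - (l + 2) * (l + 1) * ip X l (Dop X l h) (Dop X l h)| ≤
      γ * ((l + 2) * ((l + 1) * ip X (l + 1) h h)) := by
    rw [← sum_pairs_eq X hl, ← hnorm, ip_eq_sum_univ X l, mul_sum, ← sum_sub_distrib, mul_sum,
      mul_sum]
    exact (abs_sum_le_sum_abs _ _).trans (sum_le_sum fun s _ => hX.link_estimate hγ hl h s)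
  have hpos : (0 : ℝ) < (l + 2) ^ 2 := by positivity
  have hn : 0 ≤ ip X (l + 1) h h := by rw [ip_self]; positivity
  refine le_of_mul_le_mul_left ?_ hpos
  rw [← abs_of_pos hpos, ← abs_mul, abs_of_pos hpos]
  calc _ = _ := by congr 1; field_simp
    _ ≤ _ := key
    _ ≤ _ := by nlinarith [mul_nonneg hγ hn, (Nat.cast_nonneg l : (0 : ℝ) ≤ l)]

theorem ip_Uop_zero (X : WSC n d) (hd : 0 < d) (h : Cf n) :
    ip X 1 (Uop X 0 h) (Uop X 0 h) = ip X 0 h h := by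
  have hs := sum_w_mul_sum_erase X hd fun s => h s ^ 2
  rw [ip_eq_sum_univ, ip_eq_sum_univ]
  simp only [Nat.cast_zero, zero_add, one_mul, sq, ← mul_assoc] at hs
  rw [← hs]
  refine sum_congr rfl fun t _ => ?_
  by_cases ht : t ∈ X.faces 1
  · have hU := Uop_apply_face X hd h ht
    obtain ⟨a, rfl⟩ := card_eq_one.1 (X.card_mem _ _ ht)
    simp only [Nat.cast_zero, zero_add, one_mul, sum_singleton] at hU ⊢
    rw [hU, mul_assoc]
  · simp [X.w_zero _ _ ht]

/-- The defect `D U - (1/(L+1)) Id - (L/(L+1)) U D` of the commutation relation at level `L`. -/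
noncomputable def commDefect (X : WSC n d) (L : ℕ) (h : Cf n) : Cf n :=
  Dop X L (Uop X L h) - (1 / (L + 1 : ℝ)) • h -
    ((L : ℝ) / (L + 1)) • Uop X (L - 1) (Dop X (L - 1) h)

theorem ip_commDefect (X : WSC n d) {L : ℕ} (hL : L < d) (f h : Cf n) :
    ip X L f (commDefect X L h) = ip X (L + 1) (Uop X L f) (Uop X L h) -
      1 / (L + 1 : ℝ) * ip X L f h -
      (L : ℝ) / (L + 1) * ip X (L - 1) (Dop X (L - 1) f) (Dop X (L - 1) h) := by
  rw [commDefect, ip_sub_right, ip_sub_right, ip_smul_right, ip_smul_right, ip_Uop_left X hL]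
  rcases L with _ | l
  · simp
  · rw [Nat.add_sub_cancel, ip_comm X (l + 1) f (Uop X l _), ip_Uop_left X (by omega),
      ip_comm X l (Dop X l f)]

theorem IsLSE.abs_ip_commDefect_self_le {X : WSC n d} {γ : ℝ} (hγ : 0 ≤ γ) (hX : IsLSE X γ) {L : ℕ}
    (hL : L < d) (h : Cf n) : |ip X L h (commDefect X L h)| ≤ γ * norm2 X L h ^ 2 := by
  rw [ip_commDefect X hL, ← ip_self]
  rcases L with _ | l
  · have hn : 0 ≤ ip X 0 h h := by rw [ip_self]; positivity
    simpa [ip_Uop_zero X hL] using mul_nonneg hγ hn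
  · have := hX.abs_quadratic_le hγ (l := l) (by omega) h
    rw [Nat.add_sub_cancel]
    push_cast
    rwa [show (l + 1 + 1 : ℝ) = l + 2 by ring]

theorem commDefect_add (X : WSC n d) (L : ℕ) (f g : Cf n) :
    commDefect X L (f + g) = commDefect X L f + commDefect X L g := by
  simp only [commDefect, ← upLin_apply, ← downLin_apply, map_add, smul_add]
  abel

theorem commDefect_smul (X : WSC n d) (L : ℕ) (c : ℝ) (f : Cf n) :
    commDefect X L (c • f) = c • commDefect X L f := by
  simp only [commDefect, ← upLin_apply, ← downLin_apply, map_smul, smul_sub, smul_comm c]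

theorem ip_commDefect_comm (X : WSC n d) {L : ℕ} (hL : L < d) (f h : Cf n) :
    ip X L f (commDefect X L h) = ip X L h (commDefect X L f) := by
  rw [ip_commDefect X hL, ip_commDefect X hL, ip_comm X (L + 1), ip_comm X L f,
    ip_comm X (L - 1)]

/-- A symmetric operator whose quadratic form is bounded by `γ ‖·‖²` has norm at most `γ`. -/
theorem IsLSE.norm2_commDefect_le {X : WSC n d} {γ : ℝ} (hγ : 0 ≤ γ) (hX : IsLSE X γ) {L : ℕ}
    (hL : L < d) (h : Cf n) : norm2 X L (commDefect X L h) ≤ γ * norm2 X L h := by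
  set e := commDefect X L h with he
  set N := norm2 X L h with hN
  set M := norm2 X L e with hM
  have hN0 : 0 ≤ N := norm2_nonneg _ _ _
  have hM0 : 0 ≤ M := norm2_nonneg _ _ _
  have hsymm : ip X L h (commDefect X L e) = ip X L e e := ip_commDefect_comm X hL h e
  have hpol : ∀ a b : ℝ, 2 * (a * b) * M ^ 2 ≤ γ * (a ^ 2 * N ^ 2 + b ^ 2 * M ^ 2) := by
    intro a b
    have hquad : ∀ c : ℝ, ip X L (a • h + c • e) (commDefect X L (a • h + c • e)) =
        a ^ 2 * ip X L h e + 2 * (a * c) * M ^ 2 + c ^ 2 * ip X L e (commDefect X L e) := by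
      intro c
      simp only [commDefect_add, commDefect_smul, ip_add_right, ip_add_left, ip_smul_right,
        ip_smul_left, ← he, hsymm]
      rw [ip_self X L e]
      ring
    have hnorm : ∀ c : ℝ, norm2 X L (a • h + c • e) ^ 2 =
        a ^ 2 * N ^ 2 + 2 * (a * c) * ip X L h e + c ^ 2 * M ^ 2 := by
      intro c
      rw [← ip_self]
      simp only [ip_add_right, ip_add_left, ip_smul_right, ip_smul_left]
      rw [ip_self, ip_self, ip_comm X L e h]
      ring
    have h1 := abs_le.1 (hX.abs_ip_commDefect_self_le hγ hL (a • h + b • e))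
    have h2 := abs_le.1 (hX.abs_ip_commDefect_self_le hγ hL (a • h + (-b) • e))
    rw [hquad, hnorm] at h1 h2
    nlinarith [h1.2, h2.1]
  rcases hM0.eq_or_lt with hM' | hM'
  · rw [← hM']
    positivity
  rcases hN0.eq_or_lt with hN' | hN'
  · have h3 := hpol (γ + 1) 1
    rw [← hN'] at h3
    nlinarith [pow_pos hM' 2]
  · have h3 := hpol M N
    have hp : 0 < M ^ 2 * N := by positivity
    refine le_of_mul_le_mul_left ?_ hp
    linarith

/-! ### Commuting the down operator past iterated up operators -/

/-- The defect of `D U_i^{i+m+1} ≈ ((m+1)/(i+m+1)) U_i^{i+m} + (i/(i+m+1)) U_{i-1}^{i+m} D`. -/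
noncomputable def iterDefect (X : WSC n d) (i m : ℕ) (g : Cf n) : Cf n :=
  Dop X (i + m) (Uc X i (m + 1) g) - ((m + 1 : ℝ) / (i + m + 1)) • Uc X i m g -
    ((i : ℝ) / (i + m + 1)) • Uc X (i - 1) (m + 1) (Dop X (i - 1) g)

theorem iterDefect_succ (X : WSC n d) (i m : ℕ) (g : Cf n) :
    iterDefect X i (m + 1) g = commDefect X (i + m + 1) (Uc X i (m + 1) g) +
      ((i + m + 1 : ℝ) / (i + m + 2)) • Uop X (i + m) (iterDefect X i m g) := by
  have hU : (i : ℝ) • Uc X (i - 1) (m + 2) (Dop X (i - 1) g) =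
      (i : ℝ) • Uop X (i + m) (Uc X (i - 1) (m + 1) (Dop X (i - 1) g)) := by
    rcases i with _ | i
    · simp
    · rw [show i + 1 + m = i + 1 - 1 + (m + 1) by omega]
      rfl
  have h1 : (i + m + 1 : ℝ) ≠ 0 := by positivity
  have h2 : (i + m + 2 : ℝ) ≠ 0 := by positivity
  simp only [iterDefect, commDefect, Nat.add_sub_cancel, ← upLin_apply, ← downLin_apply, map_sub,
    map_smul] at hU ⊢
  ext τ
  have hUτ := congrFun hU τ
  simp only [Pi.add_apply, Pi.sub_apply, Pi.smul_apply, smul_eq_mul, Nat.cast_add, Nat.cast_one,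
    ← add_assoc, upLin_apply, downLin_apply, Uc] at hUτ ⊢
  simp only [show (i + m + 1 + 1 : ℝ) = i + m + 2 by ring]
  field_simp
  linear_combination -hUτ

theorem IsLSE.norm2_iterDefect_le {X : WSC n d} {γ : ℝ} (hγ : 0 ≤ γ) (hX : IsLSE X γ) (i : ℕ)
    (g : Cf n) (m : ℕ) (hm : i + m < d) :
    norm2 X (i + m) (iterDefect X i m g) ≤ (m + 1) * γ * norm2 X i g := by
  induction m with
  | zero =>
    have h : iterDefect X i 0 g = commDefect X i g := by
      simp [iterDefect, commDefect, Uc]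
    simpa [h] using hX.norm2_commDefect_le hγ hm g
  | succ m ih =>
    rw [iterDefect_succ]
    have hc : (i + m + 1 : ℝ) / (i + m + 2) ≤ 1 := by
      rw [div_le_one (by positivity)]; linarith
    have hE := hX.norm2_commDefect_le hγ hm (Uc X i (m + 1) g)
    have hU := norm2_Uc_le X i g (m + 1) (by omega)
    have hI := (norm2_Uop_le X (l := i + m) (by omega) (iterDefect X i m g)).trans (ih (by omega))
    refine (norm2_add_le _ _ _ _).trans ?_
    rw [norm2_smul X _ (by positivity)]
    have h1 := mul_le_mul_of_nonneg_left hU hγ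
    have h2 := mul_le_of_le_one_left
      (norm2_nonneg X (i + m + 1) (Uop X (i + m) (iterDefect X i m g))) hc
    simp only [← add_assoc] at hE h1 ⊢
    push_cast
    linarith

theorem Dop_Uc_succ (X : WSC n d) (i m : ℕ) (g : Cf n) :
    Dop X (i + m) (Uc X i (m + 1) g) = ((m + 1 : ℝ) / (i + m + 1)) • Uc X i m g +
      ((i : ℝ) / (i + m + 1)) • Uc X (i - 1) (m + 1) (Dop X (i - 1) g) + iterDefect X i m g := by
  rw [iterDefect]
  abel

/-- A function nearly annihilated by the down operator nearly satisfies
`‖U_i^{i+m} g‖² = ‖g‖² / C(i+m,i)`. -/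
theorem IsLSE.abs_norm2_Uc_sq_sub_le {X : WSC n d} {γ : ℝ} (hγ : 0 ≤ γ) (hX : IsLSE X γ) {i : ℕ}
    (hi : 0 < i) (g : Cf n) (m : ℕ) (hm : i + m ≤ d) :
    |norm2 X (i + m) (Uc X i m g) ^ 2 - norm2 X i g ^ 2 / ((i + m).choose i : ℝ)| ≤
      m * (norm2 X i g * norm2 X (i - 1) (Dop X (i - 1) g) + m * γ * norm2 X i g ^ 2) := by
  set G := norm2 X i g
  set b := norm2 X (i - 1) (Dop X (i - 1) g)
  have hG : 0 ≤ G := norm2_nonneg _ _ _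
  have hb : 0 ≤ b := norm2_nonneg _ _ _
  induction m with
  | zero => simp [Uc, G]
  | succ m ih =>
    have ih := ih (by omega)
    have hip : norm2 X (i + (m + 1)) (Uc X i (m + 1) g) ^ 2 =
        ip X (i + m) (Uc X i m g) (Dop X (i + m) (Uc X i (m + 1) g)) := by
      rw [← ip_Uop_left X (by omega), ← ip_self]
      rfl
    rw [hip, Dop_Uc_succ, ip_add_right, ip_add_right, ip_smul_right, ip_smul_right, ip_self]
    have hpos : (0 : ℝ) < i + m + 1 := by positivity
    have hUG : norm2 X (i + m) (Uc X i m g) ≤ G := norm2_Uc_le X i g m (by omega)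
    have hd1 : norm2 X (i + m) (Uc X (i - 1) (m + 1) (Dop X (i - 1) g)) ≤ b := by
      have := norm2_Uc_le X (i - 1) (Dop X (i - 1) g) (m + 1) (by omega)
      rwa [show i - 1 + (m + 1) = i + m by omega] at this
    have t1 : |ip X (i + m) (Uc X i m g) (Uc X (i - 1) (m + 1) (Dop X (i - 1) g))| ≤ G * b :=
      (abs_ip_le _ _ _ _).trans (mul_le_mul hUG hd1 (norm2_nonneg _ _ _) hG)
    have t2 : |ip X (i + m) (Uc X i m g) (iterDefect X i m g)| ≤ G * ((m + 1) * γ * G) :=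
      (abs_ip_le _ _ _ _).trans (mul_le_mul hUG (hX.norm2_iterDefect_le hγ i g m (by omega))
        (norm2_nonneg _ _ _) hG)
    have hc1 : (i : ℝ) / (i + m + 1) ≤ 1 := by
      rw [div_le_one hpos]; linarith [(Nat.cast_nonneg m : (0 : ℝ) ≤ m)]
    have hc2 : (m + 1 : ℝ) / (i + m + 1) ≤ 1 := by
      rw [div_le_one hpos]; linarith [(Nat.cast_nonneg i : (0 : ℝ) ≤ i)]
    have hc0 : (0 : ℝ) ≤ i / (i + m + 1) := by positivity
    have hc3 : (0 : ℝ) ≤ (m + 1) / (i + m + 1) := by positivity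
    have hch : G ^ 2 / ((i + (m + 1)).choose i : ℝ) =
        (m + 1 : ℝ) / (i + m + 1) * (G ^ 2 / ((i + m).choose i : ℝ)) := by
      have h1 : ((i + m).choose i : ℝ) ≠ 0 := by
        exact_mod_cast (Nat.choose_pos (by omega)).ne'
      have h2 : ((i + (m + 1)).choose i : ℝ) ≠ 0 := by
        exact_mod_cast (Nat.choose_pos (by omega)).ne'
      have h3 := Nat.choose_mul_succ_eq (i + m) i
      rw [show i + m + 1 - i = m + 1 by omega] at h3
      have h4 : ((i + m).choose i : ℝ) * (i + m + 1) = (i + (m + 1)).choose i * (m + 1) := by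
        exact_mod_cast h3
      field_simp
      linear_combination G ^ 2 * h4
    rw [hch]
    set A := norm2 X (i + m) (Uc X i m g) ^ 2 - G ^ 2 / ((i + m).choose i : ℝ) with hA
    set x := ip X (i + m) (Uc X i m g) (Uc X (i - 1) (m + 1) (Dop X (i - 1) g))
    set y := ip X (i + m) (Uc X i m g) (iterDefect X i m g)
    have e1 : |(m + 1 : ℝ) / (i + m + 1) * A| ≤ |A| := by
      rw [abs_mul, abs_of_nonneg hc3]; exact mul_le_of_le_one_left (abs_nonneg _) hc2
    have e2 : |(i : ℝ) / (i + m + 1) * x| ≤ |x| := by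
      rw [abs_mul, abs_of_nonneg hc0]; exact mul_le_of_le_one_left (abs_nonneg _) hc1
    have hsplit : (m + 1 : ℝ) / (i + m + 1) * norm2 X (i + m) (Uc X i m g) ^ 2 +
        (i : ℝ) / (i + m + 1) * x + y -
        (m + 1 : ℝ) / (i + m + 1) * (G ^ 2 / ((i + m).choose i : ℝ)) =
        (m + 1 : ℝ) / (i + m + 1) * A + (i : ℝ) / (i + m + 1) * x + y := by
      rw [hA]; ring
    rw [hsplit]
    refine (abs_add_three _ _ _).trans ?_
    push_cast
    have : 0 ≤ (m : ℝ) * (γ * G ^ 2) := by positivity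
    nlinarith

/-! ### Bounds on the Bottom-Up level functions -/

theorem gLevel_eq (X : WSC n d) (k : ℕ) (f : Cf n) (i : ℕ) :
    gLevel X k f i = Dc X k (k - i) f -
      ∑ j ∈ range i, (i.choose j : ℝ) • Uc X j (i - j) (gLevel X k f j) := by
  rw [gLevel, sum_attach (range i) fun j => (i.choose j : ℝ) • Uc X j (i - j) (gLevel X k f j)]

theorem Dc_sub_eq (X : WSC n d) {k i : ℕ} (hi : i < k) (f : Cf n) :
    Dc X k (k - i) f = Dop X i (Dc X k (k - (i + 1)) f) := by
  rw [show k - i = k - (i + 1) + 1 by omega, Dc, show k - (k - (i + 1) + 1) = i by omega]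

theorem norm2_Dc_mono (X : WSC n d) {k : ℕ} (hk : k ≤ d) (f : Cf n) {j i : ℕ} (hji : j ≤ i)
    (hi : i ≤ k) : norm2 X j (Dc X k (k - j) f) ≤ norm2 X i (Dc X k (k - i) f) := by
  induction i, hji using Nat.le_induction with
  | base => exact le_rfl
  | succ i hji ih =>
    refine (ih (by omega)).trans ?_
    rw [Dc_sub_eq X (by omega)]
    exact norm2_Dop_le X (by omega) _

theorem choose_le_pow_sub {i j k : ℕ} (hji : j ≤ i) (hik : i ≤ k) :
    (i.choose j : ℝ) ≤ (k : ℝ) ^ (i - j) := by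
  rw [← Nat.choose_symm hji]
  exact_mod_cast (Nat.choose_le_pow i (i - j)).trans (Nat.pow_le_pow_left hik _)

theorem norm2_gLevel_le (X : WSC n d) {k : ℕ} (hk : k ≤ d) (hk1 : 1 ≤ k) (f : Cf n) {H : ℝ} (I : ℕ)
    (hI : I ≤ k) (hH : norm2 X I (Dc X k (k - I) f) ≤ H) (i : ℕ) (hi : i ≤ I) :
    norm2 X i (gLevel X k f i) ≤ (2 * k) ^ i * H := by
  induction i using Nat.strong_induction_on with
  | _ i ih =>
    have hH0 : 0 ≤ H := (norm2_nonneg _ _ _).trans hH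
    have hk1' : (1 : ℝ) ≤ k := by exact_mod_cast hk1
    rw [gLevel_eq]
    refine (norm2_sub_le _ _ _ _).trans ?_
    have hsum : norm2 X i (∑ j ∈ range i, (i.choose j : ℝ) • Uc X j (i - j) (gLevel X k f j)) ≤
        ∑ j ∈ range i, 2 ^ j * ((k : ℝ) ^ i * H) := by
      refine (norm2_sum_le _ _ _ _).trans (sum_le_sum fun j hj => ?_)
      have hj : j < i := mem_range.1 hj
      rw [norm2_smul X _ (by positivity)]
      have hU := norm2_Uc_le X j (gLevel X k f j) (i - j) (by omega)
      rw [Nat.add_sub_cancel' hj.le] at hU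
      refine (mul_le_mul (choose_le_pow_sub hj.le (hi.trans hI)) (hU.trans (ih j hj (by omega)))
        (norm2_nonneg _ _ _) (by positivity)).trans_eq ?_
      rw [← pow_sub_mul_pow (k : ℝ) hj.le, mul_pow]
      ring
    rw [← sum_mul, geom_sum_eq (by norm_num) i] at hsum
    have h1 := (norm2_Dc_mono X hk f hi hI).trans hH
    have h2 : (1 : ℝ) ≤ (k : ℝ) ^ i := one_le_pow₀ hk1'
    rw [mul_pow]
    nlinarith [mul_le_mul_of_nonneg_right h2 hH0]

theorem Dop_gLevel_succ (X : WSC n d) {k i : ℕ} (hi : i < k) (f : Cf n) :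
    Dop X i (gLevel X k f (i + 1)) = -∑ j ∈ range (i + 1), ((i + 1).choose j : ℝ) •
      (((j : ℝ) / (i + 1)) • Uc X (j - 1) (i - j + 1) (Dop X (j - 1) (gLevel X k f j)) +
        iterDefect X j (i - j) (gLevel X k f j)) := by
  have hD : Dc X k (k - i) f = ∑ j ∈ range (i + 1),
      (i.choose j : ℝ) • Uc X j (i - j) (gLevel X k f j) := by
    rw [sum_range_succ, gLevel_eq X k f i]
    simp [Uc]
  rw [gLevel_eq, ← downLin_apply, map_sub, downLin_apply, ← Dc_sub_eq X hi, hD, map_sum,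
    ← sum_sub_distrib, ← sum_neg_distrib]
  refine sum_congr rfl fun j hj => ?_
  have hj : j ≤ i := by have := mem_range.1 hj; omega
  have hDU := Dop_Uc_succ X j (i - j) (gLevel X k f j)
  rw [Nat.add_sub_cancel' hj] at hDU
  rw [map_smul, downLin_apply, show i + 1 - j = i - j + 1 by omega, hDU]
  have hch : (i.choose j : ℝ) * (i + 1) = (i + 1).choose j * (i + 1 - j) := by
    have := Nat.choose_mul_succ_eq i j
    rw [← Nat.cast_inj (R := ℝ)] at this
    push_cast [show j ≤ i + 1 by omega] at this
    exact this
  have hpos : (i + 1 : ℝ) ≠ 0 := by positivity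
  ext τ
  simp only [Pi.add_apply, Pi.sub_apply, Pi.smul_apply, Pi.neg_apply, smul_eq_mul]
  rw [Nat.cast_sub hj, show (j + (i - j) + 1 : ℝ) = i + 1 by ring]
  field_simp
  linear_combination (Uc X j (i - j) (gLevel X k f j) τ) * hch

theorem IsLSE.norm2_Dop_gLevel_le {X : WSC n d} {γ : ℝ} (hγ : 0 ≤ γ) (hX : IsLSE X γ) {k : ℕ}
    (hk : k ≤ d) (hk1 : 1 ≤ k) (f : Cf n) {H : ℝ} (I : ℕ) (hI : I ≤ k)
    (hH : norm2 X I (Dc X k (k - I) f) ≤ H) (i : ℕ) (hi0 : 0 < i) (hi : i ≤ I) :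
    norm2 X (i - 1) (Dop X (i - 1) (gLevel X k f i)) ≤ γ * k * (4 * k) ^ i * H := by
  induction i using Nat.strong_induction_on with
  | _ i ih =>
    obtain ⟨i, rfl⟩ : ∃ l, i = l + 1 := ⟨i - 1, by omega⟩
    have hH0 : 0 ≤ H := (norm2_nonneg _ _ _).trans hH
    rw [Nat.add_sub_cancel, Dop_gLevel_succ X (by omega), norm2_neg]
    have hterm : ∀ j ∈ range (i + 1), norm2 X i (((i + 1).choose j : ℝ) •
        (((j : ℝ) / (i + 1)) • Uc X (j - 1) (i - j + 1) (Dop X (j - 1) (gLevel X k f j)) +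
          iterDefect X j (i - j) (gLevel X k f j))) ≤
        (4 ^ j + 2 ^ j) * (γ * k * k ^ (i + 1) * H) := by
      intro j hj
      have hj : j ≤ i := by have := mem_range.1 hj; omega
      have hE := hX.norm2_iterDefect_le hγ j (gLevel X k f j) (i - j) (by omega)
      rw [Nat.add_sub_cancel' hj] at hE
      have hg := norm2_gLevel_le X hk hk1 f I hI hH j (by omega)
      have hij : (((i - j : ℕ) : ℝ) + 1) ≤ k := by
        exact_mod_cast (by omega : i - j + 1 ≤ k)
      have hE' : norm2 X i (iterDefect X j (i - j) (gLevel X k f j)) ≤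
          γ * k * (2 * k) ^ j * H := by
        calc _ ≤ _ := hE
          _ ≤ (k * γ) * ((2 * k) ^ j * H) := by
            refine mul_le_mul (mul_le_mul_of_nonneg_right hij hγ) hg (norm2_nonneg _ _ _)
              (by positivity)
          _ = _ := by ring
      have hD : norm2 X i (((j : ℝ) / (i + 1)) •
          Uc X (j - 1) (i - j + 1) (Dop X (j - 1) (gLevel X k f j))) ≤
          γ * k * (4 * k) ^ j * H := by
        rw [norm2_smul X _ (by positivity)]
        rcases Nat.eq_zero_or_pos j with rfl | hj0
        · simp only [Nat.cast_zero, zero_div, zero_mul]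
          positivity
        · have hU := norm2_Uc_le X (j - 1) (Dop X (j - 1) (gLevel X k f j)) (i - j + 1) (by omega)
          rw [show j - 1 + (i - j + 1) = i by omega] at hU
          have hc : (j : ℝ) / (i + 1) ≤ 1 := by
            rw [div_le_one (by positivity)]
            exact_mod_cast (by omega : j ≤ i + 1)
          exact (mul_le_of_le_one_left (norm2_nonneg _ _ _) hc).trans
            (hU.trans (ih j (by omega) hj0 (by omega)))
      rw [norm2_smul X _ (by positivity)]
      refine (mul_le_mul (choose_le_pow_sub (by omega : j ≤ i + 1) (hi.trans hI))
        ((norm2_add_le _ _ _ _).trans (add_le_add hD hE')) (norm2_nonneg _ _ _)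
        (by positivity)).trans_eq ?_
      rw [← pow_sub_mul_pow (k : ℝ) (show j ≤ i + 1 by omega), mul_pow, mul_pow]
      ring
    refine (norm2_sum_le _ _ _ _).trans ((sum_le_sum hterm).trans ?_)
    rw [← sum_mul, sum_add_distrib, geom_sum_eq (by norm_num), geom_sum_eq (by norm_num),
      mul_pow (4 : ℝ)]
    have hpow : (2 : ℝ) ^ (i + 1) ≤ 4 ^ (i + 1) / 2 := by
      have : (2 : ℝ) ^ i ≤ 4 ^ i := pow_le_pow_left₀ (by norm_num) (by norm_num) i
      rw [pow_succ, pow_succ]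
      linarith
    have hZ : 0 ≤ γ * k * (k : ℝ) ^ (i + 1) * H := by positivity
    have hco : ((4 : ℝ) ^ (i + 1) - 1) / (4 - 1) + (2 ^ (i + 1) - 1) / (2 - 1) ≤ 4 ^ (i + 1) := by
      have : (0 : ℝ) < 4 ^ (i + 1) := by positivity
      linarith
    linarith [mul_le_mul_of_nonneg_right hco hZ]

/-! ### The constant level -/

theorem WSC.sum_w (X : WSC n d) {l : ℕ} (hl : l ≤ d) : ∑ s, X.w l s = 1 := by
  induction hl using Nat.decreasingInduction with
  | self =>
    rw [← X.w_top_sum]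
    exact (sum_subset (subset_univ _) fun s _ h => X.w_zero _ _ h).symm
  | of_succ l hl ih =>
    have h := sum_w_mul_sum_erase X hl fun _ => 1
    have hcard : ∑ t, X.w (l + 1) t * ∑ _a ∈ t, (1 : ℝ) = (l + 1) * ∑ t, X.w (l + 1) t := by
      rw [mul_sum]
      refine sum_congr rfl fun t _ => ?_
      by_cases ht : t ∈ X.faces (l + 1)
      · rw [sum_const, X.card_mem _ _ ht, nsmul_eq_mul]
        push_cast
        ring
      · simp [X.w_zero _ _ ht]
    rw [hcard, ih] at h
    simp only [mul_one] at h
    have h0 : (l + 1 : ℝ) ≠ 0 := by positivity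
    exact mul_left_cancel₀ h0 (h.symm.trans (mul_one _).symm)

theorem Uc_zero_apply (X : WSC n d) (g : Cf n) (m : ℕ) (hm : m ≤ d) :
    ∀ t ∈ X.faces m, Uc X 0 m g t = g ∅ := by
  induction m with
  | zero =>
    intro t ht
    rw [card_eq_zero.1 (X.card_mem _ _ ht), Uc]
  | succ m ih =>
    intro t ht
    have h := Uop_apply_face X (by omega) (Uc X 0 m g) ht
    rw [sum_congr rfl fun a ha => ih (by omega) _ (X.erase_mem_faces (by omega) ha ht), sum_const,
      X.card_mem _ _ ht, nsmul_eq_mul, Nat.cast_succ] at h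
    rw [Uc, Nat.zero_add]
    exact mul_left_cancel₀ (by positivity) h

theorem ip_Uc_zero (X : WSC n d) (g : Cf n) (m : ℕ) (hm : m ≤ d) :
    ip X m (Uc X 0 m g) (Uc X 0 m g) = g ∅ ^ 2 := by
  calc _ = ∑ t, X.w m t * g ∅ ^ 2 := by
        rw [ip_eq_sum_univ]
        refine sum_congr rfl fun t _ => ?_
        by_cases ht : t ∈ X.faces m
        · rw [Uc_zero_apply X g m hm t ht]
          ring
        · simp [X.w_zero _ _ ht]
    _ = _ := by rw [← sum_mul, X.sum_w hm, one_mul]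

theorem ip_fLevel (X : WSC n d) {k i : ℕ} (hi : i ≤ k) (f : Cf n) :
    1 / (k.choose i : ℝ) * ip X k (fLevel X k f i) (fLevel X k f i) =
      k.choose i * ip X k (Uc X i (k - i) (gLevel X k f i)) (Uc X i (k - i) (gLevel X k f i)) := by
  have : (k.choose i : ℝ) ≠ 0 := by exact_mod_cast (Nat.choose_pos hi).ne'
  rw [fLevel, ip_smul_left, ip_smul_right]
  field_simp

theorem bottomUp_constant_le {k i : ℕ} (hk : 2 ≤ k) (hi : 0 < i) :
    (k : ℝ) ^ i * (k * ((2 * k) ^ i * (k * (4 * k) ^ i) + k * ((2 * k) ^ i) ^ 2)) ≤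
      (k : ℝ) ^ (10 * i) := by
  have hk2 : (2 : ℝ) ≤ k := by exact_mod_cast hk
  have hk0 : (0 : ℝ) ≤ k := by linarith
  have h2 : (2 * k : ℝ) ^ i ≤ (k : ℝ) ^ (2 * i) := by
    rw [pow_mul]
    exact pow_le_pow_left₀ (by positivity) (by nlinarith) i
  have h4 : (4 * k : ℝ) ^ i ≤ (k : ℝ) ^ (3 * i) := by
    rw [pow_mul]
    exact pow_le_pow_left₀ (by positivity) (by nlinarith [mul_nonneg hk0 (sub_nonneg.2 hk2)]) i
  have hk1 : (1 : ℝ) ≤ k := by linarith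
  calc _ ≤ (k : ℝ) ^ i * (k * ((k : ℝ) ^ (2 * i) * (k * (k : ℝ) ^ (3 * i)) +
        k * ((k : ℝ) ^ (2 * i)) ^ 2)) := by gcongr
    _ = (k : ℝ) ^ (6 * i + 2) + (k : ℝ) ^ (5 * i + 2) := by ring
    _ ≤ (k : ℝ) ^ (6 * i + 2) + (k : ℝ) ^ (6 * i + 2) := by
      gcongr
      norm_num
    _ = 2 * (k : ℝ) ^ (6 * i + 2) := by ring
    _ ≤ k * (k : ℝ) ^ (6 * i + 2) := by gcongr
    _ = (k : ℝ) ^ (6 * i + 3) := by ring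
    _ ≤ _ := pow_le_pow_right₀ hk1 (by omega)

/-- norms of `g_i` vs `f_i^↑`: there is a universal constant `C > 0`
such that on any two-sided `γ`-local-spectral expander, for `f ∈ C_k` and `i ≤ k`,
`|⟨g_i, g_i⟩ − (1/C(k,i))·⟨f_i^↑, f_i^↑⟩| ≤ k^{Ci}·γ·‖D_i^k f‖₂²`. -/
theorem stmt9 : ∃ C : ℝ, 0 < C ∧
    ∀ (n d : ℕ) (X : WSC n d) (γ : ℝ), 0 ≤ γ → IsLSE X γ →
    ∀ (k : ℕ), k ≤ d → ∀ (f : Cf n) (i : ℕ), i ≤ k →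
    |ip X i (gLevel X k f i) (gLevel X k f i) -
        (1 / (k.choose i : ℝ)) * ip X k (fLevel X k f i) (fLevel X k f i)| ≤
      (k:ℝ) ^ (C * (i:ℝ)) * γ * ip X i (Dc X k (k-i) f) (Dc X k (k-i) f) := by
  refine ⟨10, by norm_num, ?_⟩
  intro n d X γ hγ hX k hk f i hi
  rw [ip_fLevel X hi]
  set g := gLevel X k f i with hg
  have hrhs : 0 ≤ (k : ℝ) ^ ((10 : ℝ) * (i : ℝ)) * γ *
      ip X i (Dc X k (k - i) f) (Dc X k (k - i) f) := by
    rw [ip_self]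
    positivity
  rcases Nat.eq_zero_or_pos i with rfl | hi0
  · have h0 : ip X 0 g g = g ∅ ^ 2 := ip_Uc_zero X g 0 (by omega)
    rw [h0, Nat.sub_zero, ip_Uc_zero X g k hk]
    simpa using hrhs
  rcases hi.eq_or_lt with rfl | hik
  · simpa [Uc] using hrhs
  set H := norm2 X i (Dc X k (k - i) f) with hH
  have hH0 : 0 ≤ H := norm2_nonneg _ _ _
  have hG := norm2_gLevel_le X hk (by omega) f i hi hH.ge i le_rfl
  have hb := hX.norm2_Dop_gLevel_le hγ hk (by omega) f i hi hH.ge i hi0 le_rfl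
  have key := hX.abs_norm2_Uc_sq_sub_le hγ hi0 g (k - i) (by omega)
  rw [Nat.add_sub_cancel' hi] at key
  rw [← hg] at hG hb
  set G := norm2 X i g
  set b := norm2 X (i - 1) (Dop X (i - 1) g)
  have hG0 : 0 ≤ G := norm2_nonneg _ _ _
  have hb0 : 0 ≤ b := norm2_nonneg _ _ _
  have hc0 : (0 : ℝ) < k.choose i := by exact_mod_cast Nat.choose_pos hi
  have hc : (k.choose i : ℝ) ≤ (k : ℝ) ^ i := by exact_mod_cast Nat.choose_le_pow k i
  have hm : ((k - i : ℕ) : ℝ) ≤ k := by exact_mod_cast Nat.sub_le k i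
  rw [ip_self, ip_self, ip_self]
  have hscale : |G ^ 2 - k.choose i * norm2 X k (Uc X i (k - i) g) ^ 2| =
      k.choose i * |norm2 X k (Uc X i (k - i) g) ^ 2 - G ^ 2 / (k.choose i : ℝ)| := by
    rw [abs_sub_comm, ← abs_of_pos hc0, ← abs_mul, abs_of_pos hc0]
    congr 1
    field_simp
  have hpow : (k : ℝ) ^ ((10 : ℝ) * (i : ℝ)) = (k : ℝ) ^ (10 * i) := by
    exact_mod_cast Real.rpow_natCast (k : ℝ) (10 * i)
  rw [hscale, hpow]
  calc _ ≤ (k : ℝ) ^ i * (k * (((2 * k) ^ i * H) * (γ * k * (4 * k) ^ i * H) +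
        k * γ * ((2 * k) ^ i * H) ^ 2)) := by
        refine mul_le_mul hc (key.trans ?_) (abs_nonneg _) (by positivity)
        gcongr
    _ = ((k : ℝ) ^ i * (k * ((2 * k) ^ i * (k * (4 * k) ^ i) + k * ((2 * k) ^ i) ^ 2))) *
        (γ * H ^ 2) := by ring
    _ ≤ (k : ℝ) ^ (10 * i) * (γ * H ^ 2) := by
        gcongr
        exact bottomUp_constant_le (by omega) hi0
    _ = _ := by ring
end

section
/- Let (X,Π) be a d-dimensional weighted pure simplicial complex and f ∈ C_k. For any face υ of X, let g_ℓ^{(υ)} denote the ℓ-th Bottom-Up level function of the restriction f|_υ computed within the link X_υ. Then for all j ≤ i ≤ k and every τ ∈ X(j), the restriction of the level function satisfies, as functions on X_τ(i−j): g_i|_τ = Σ_{σ ⊆ τ} (−1)^{|σ|}·g_{i−j}^{(τ∖σ)} (where each g_{i−j}^{(τ∖σ)} is evaluated on the given (i−j)-face of X_τ, which is also a face of X_{τ∖σ}). -/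
open Finset

variable {n d : ℕ}

/-- The alternating sum of `F` over the subsets of `s`. -/
def altSum (F : Cf n) (s : Finset (Fin n)) : ℝ :=
  ∑ T ∈ s.powerset, (-1 : ℝ) ^ ((s \ T).card) * F T

theorem altSum_insert (F : Cf n) {a : Fin n} {s : Finset (Fin n)} (ha : a ∉ s) :
    altSum F (insert a s) = altSum (fun T => F (insert a T)) s - altSum F s := by
  unfold altSum
  rw [sum_powerset_insert ha, sub_eq_neg_add, ← sum_neg_distrib]
  congr 1
  · refine sum_congr rfl fun T hT => ?_
    have haT : a ∉ T := fun h => ha (mem_powerset.mp hT h)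
    rw [insert_sdiff_of_notMem _ haT, card_insert_of_notMem (by simp [ha]), pow_succ]
    ring
  · refine sum_congr rfl fun T hT => ?_
    rw [insert_sdiff_insert, sdiff_insert_of_notMem ha]

/-- Möbius inversion on the subset lattice. -/
theorem sum_powerset_altSum (F : Cf n) (s : Finset (Fin n)) :
    ∑ σ ∈ s.powerset, altSum F σ = F s := by
  induction s using Finset.induction_on generalizing F with
  | empty => simp [altSum]
  | insert a s ha ih =>
    rw [sum_powerset_insert ha, ← sum_add_distrib, ← ih fun T => F (insert a T)]
    refine sum_congr rfl fun T hT => ?_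
    rw [altSum_insert F fun h => ha (mem_powerset.mp hT h)]
    ring

theorem altSum_union (F : Cf n) {τ I : Finset (Fin n)} (h : Disjoint I τ) :
    altSum F (τ ∪ I) =
      ∑ σ ∈ τ.powerset, (-1 : ℝ) ^ σ.card * altSum (fun T => F (τ \ σ ∪ T)) I := by
  induction τ using Finset.induction_on generalizing F with
  | empty => simp
  | insert a τ ha ih =>
    rw [disjoint_insert_right] at h
    rw [insert_union, altSum_insert F (by simp [ha, h.1]), ih _ h.2, ih _ h.2,
      sum_powerset_insert ha, sub_eq_add_neg, ← sum_neg_distrib]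
    congr 1
    · refine sum_congr rfl fun σ hσ => ?_
      have haσ : a ∉ σ := fun h => ha (mem_powerset.mp hσ h)
      simp only [insert_sdiff_of_notMem _ haσ, insert_union]
    · refine sum_congr rfl fun σ hσ => ?_
      have haσ : a ∉ σ := fun h => ha (mem_powerset.mp hσ h)
      rw [insert_sdiff_insert, sdiff_insert_of_notMem ha, card_insert_of_notMem haσ, pow_succ]
      ring

namespace WSC

theorem mem_faces_of_subset (X : WSC n d) {i : ℕ} {s t : Finset (Fin n)}
    (hs : s ∈ X.faces i) (hts : t ⊆ s) : t ∈ X.faces t.card := by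
  obtain ⟨m, hm⟩ : ∃ m, m = s.card - t.card := ⟨_, rfl⟩
  induction m generalizing t with
  | zero =>
    have hst : t = s := eq_of_subset_of_card_le hts (by omega)
    subst hst
    rwa [X.card_mem i t hs]
  | succ m ih =>
    have hcs := X.card_mem i s hs
    have hid : i ≤ d := by
      by_contra hcon
      simp [X.empty_levels i (by omega)] at hs
    obtain ⟨a, has, hat⟩ := exists_mem_notMem_of_card_lt_card (show t.card < s.card by omega)
    have hc : (insert a t).card = t.card + 1 := card_insert_of_notMem hat
    have := ih (insert_subset has hts) (by omega)
    rw [hc] at this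
    exact (X.downward _ (by omega) t).mpr ⟨rfl, _, this, subset_insert a t⟩

theorem filter_faces_subset (X : WSC n d) {i j : ℕ} {s : Finset (Fin n)} (hs : s ∈ X.faces i) :
    (X.faces j).filter (fun σ => σ ⊆ s) = powersetCard j s := by
  ext σ
  rw [mem_filter, mem_powersetCard]
  constructor
  · exact fun h => ⟨h.2, X.card_mem j σ h.1⟩
  · rintro ⟨h, rfl⟩
    exact ⟨X.mem_faces_of_subset hs h, h⟩

theorem filter_superfaces_self (X : WSC n d) {k : ℕ} {s : Finset (Fin n)} (hs : s ∈ X.faces k) :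
    (X.faces k).filter (fun ρ => s ⊆ ρ) = {s} := by
  ext ρ
  rw [mem_filter, mem_singleton]
  constructor
  · rintro ⟨hρ, hsρ⟩
    exact (eq_of_subset_of_card_le hsρ (by rw [X.card_mem _ _ hρ, X.card_mem _ _ hs])).symm
  · rintro rfl
    exact ⟨hs, Subset.rfl⟩

/-- Between `s` and `ρ` there are `|ρ| - |s|` faces with one more element than `s`. -/
theorem card_between (X : WSC n d) {i k : ℕ} {s ρ : Finset (Fin n)} (hs : s.card = i)
    (hρ : ρ ∈ X.faces k) (h : s ⊆ ρ) :
    ((X.faces (i + 1)).filter (fun t => s ⊆ t ∧ t ⊆ ρ)).card = k - i := by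
  have key : (X.faces (i + 1)).filter (fun t => s ⊆ t ∧ t ⊆ ρ) =
      (ρ \ s).image (fun a => insert a s) := by
    ext t
    simp only [mem_filter, mem_image, mem_sdiff]
    constructor
    · rintro ⟨ht, hst, htρ⟩
      have hc := X.card_mem _ t ht
      obtain ⟨a, hat, has⟩ := exists_mem_notMem_of_card_lt_card (show s.card < t.card by omega)
      refine ⟨a, ⟨htρ hat, has⟩, eq_of_subset_of_card_le (insert_subset hat hst) ?_⟩
      rw [card_insert_of_notMem has]
      omega
    · rintro ⟨a, ⟨haρ, has⟩, rfl⟩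
      have hsub := insert_subset haρ h
      have := X.mem_faces_of_subset hρ hsub
      rw [card_insert_of_notMem has, hs] at this
      exact ⟨this, subset_insert _ _, hsub⟩
  rw [key, card_image_of_injOn, card_sdiff_of_subset h, hs, X.card_mem k ρ hρ]
  intro a ha b hb hab
  simp only [coe_sdiff, Set.mem_sdiff, mem_coe] at ha hb
  have : a ∈ insert b s := by
    rw [← show insert a s = insert b s from hab]
    exact mem_insert_self a s
  exact (mem_insert.mp this).resolve_right ha.2

theorem sum_sum_superfaces (X : WSC n d) {i k : ℕ} (hik : i ≤ k) (h : Cf n) {s : Finset (Fin n)}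
    (hs : s.card = i) :
    ∑ t ∈ (X.faces (i + 1)).filter (fun t => s ⊆ t),
        ∑ ρ ∈ (X.faces k).filter (fun ρ => t ⊆ ρ), h ρ =
      ((k : ℝ) - i) * ∑ ρ ∈ (X.faces k).filter (fun ρ => s ⊆ ρ), h ρ := by
  rw [mul_sum, sum_comm' (t' := (X.faces k).filter (fun ρ => s ⊆ ρ))
    (s' := fun ρ => (X.faces (i + 1)).filter (fun t => s ⊆ t ∧ t ⊆ ρ))]
  · refine sum_congr rfl fun ρ hρ => ?_
    rw [mem_filter] at hρ
    rw [sum_const, X.card_between hs hρ.1 hρ.2, nsmul_eq_mul, Nat.cast_sub hik]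
  · intro t ρ
    simp only [mem_filter]
    constructor
    · rintro ⟨⟨h1, h2⟩, h3, h4⟩
      exact ⟨⟨h1, h2, h4⟩, h3, h2.trans h4⟩
    · rintro ⟨⟨h1, h2, h4⟩, h3, -⟩
      exact ⟨⟨h1, h2⟩, h3, h4⟩

/-- The total weight of the `k`-faces above a face is proportional to its own weight. -/
theorem exists_sum_w_superfaces (X : WSC n d) {k : ℕ} (hk : k ≤ d) (m : ℕ) (hm : m ≤ k) :
    ∃ c : ℝ, 0 < c ∧ ∀ s ∈ X.faces (k - m),
      ∑ ρ ∈ (X.faces k).filter (fun ρ => s ⊆ ρ), X.w k ρ = c * X.w (k - m) s := by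
  induction m with
  | zero =>
    refine ⟨1, one_pos, fun s hs => ?_⟩
    rw [Nat.sub_zero] at hs
    rw [X.filter_superfaces_self hs, sum_singleton, one_mul, Nat.sub_zero]
  | succ m ih =>
    obtain ⟨c, hc, hcw⟩ := ih (by omega)
    obtain ⟨i, rfl⟩ : ∃ i, k = i + (m + 1) := ⟨k - (m + 1), by omega⟩
    rw [show i + (m + 1) - m = i + 1 by omega] at hcw
    rw [Nat.add_sub_cancel]
    refine ⟨c * (i + 1) / (m + 1), by positivity, fun s hs => ?_⟩
    have hsum := X.sum_sum_superfaces (k := i + (m + 1)) (by omega) (X.w (i + (m + 1)))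
      (X.card_mem i s hs)
    rw [sum_congr rfl fun t ht => hcw t (mem_filter.mp ht).1, ← mul_sum] at hsum
    have hw := X.w_rec i (by omega) s hs
    push_cast at hsum
    rw [hw]
    field_simp
    linarith

end WSC

theorem Dc_eq_linkMean (X : WSC n d) {k : ℕ} (hk : k ≤ d) (f : Cf n) (m : ℕ) (hm : m ≤ k) :
    ∀ s ∈ X.faces (k - m), Dc X k m f s = linkMean X k s f := by
  induction m with
  | zero =>
    intro s hs
    rw [Nat.sub_zero] at hs
    have hw := X.w_pos k s hs
    rw [Dc, linkMean, X.filter_superfaces_self hs, sum_singleton, sum_singleton]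
    field_simp
  | succ m ih =>
    obtain ⟨c, hc, hcw⟩ := X.exists_sum_w_superfaces hk m (by omega)
    have ih := ih (by omega)
    obtain ⟨i, rfl⟩ : ∃ i, k = i + (m + 1) := ⟨k - (m + 1), by omega⟩
    rw [show i + (m + 1) - m = i + 1 by omega] at hcw ih
    intro s hs
    rw [Nat.add_sub_cancel] at hs
    have hA := X.sum_sum_superfaces (k := i + (m + 1)) (by omega)
      (fun ρ => X.w (i + (m + 1)) ρ * f ρ) (X.card_mem i s hs)
    have hB := X.sum_sum_superfaces (k := i + (m + 1)) (by omega) (X.w (i + (m + 1)))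
      (X.card_mem i s hs)
    rw [sum_congr rfl fun t ht => hcw t (mem_filter.mp ht).1, ← mul_sum] at hB
    have hnum : ∑ t ∈ (X.faces (i + 1)).filter (fun t => s ⊆ t),
          ∑ ρ ∈ (X.faces (i + (m + 1))).filter (fun ρ => t ⊆ ρ), X.w (i + (m + 1)) ρ * f ρ =
        c * ∑ t ∈ (X.faces (i + 1)).filter (fun t => s ⊆ t),
          X.w (i + 1) t * Dc X (i + (m + 1)) m f t := by
      rw [mul_sum]
      refine sum_congr rfl fun t ht => ?_
      have htf := (mem_filter.mp ht).1
      have hw := X.w_pos _ t htf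
      rw [ih t htf, linkMean, hcw t htf]
      field_simp
    rw [hnum] at hA
    have hm0 : ((i + (m + 1) : ℕ) : ℝ) - i ≠ 0 := by
      push_cast
      rw [add_sub_cancel_left]
      positivity
    rw [Dc, Nat.add_sub_cancel, Dop, linkMean, ← mul_div_mul_left _ _ hc.ne', hA, hB,
      mul_div_mul_left _ _ hm0]

theorem sum_sum_powersetCard_subsets (g : Cf n) {j m : ℕ} {s : Finset (Fin n)}
    (hs : s.card = j + (m + 1)) :
    ∑ t ∈ powersetCard (j + m) s, ∑ σ ∈ powersetCard j t, g σ =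
      ((m : ℝ) + 1) * ∑ σ ∈ powersetCard j s, g σ := by
  rw [mul_sum, sum_comm' (t' := powersetCard j s)
    (s' := fun σ => (s \ σ).image (fun a => s.erase a))]
  · refine sum_congr rfl fun σ hσ => ?_
    rw [mem_powersetCard] at hσ
    rw [sum_const, card_image_of_injOn, card_sdiff_of_subset hσ.1, hs, hσ.2,
      Nat.add_sub_cancel_left, nsmul_eq_mul]
    · push_cast
      ring
    · exact (erase_injOn s).mono fun a ha => (mem_sdiff.mp ha).1
  · intro t σ
    simp only [mem_powersetCard, mem_image, mem_sdiff]
    constructor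
    · rintro ⟨⟨hts, htc⟩, hσt, hσc⟩
      obtain ⟨a, has, hat⟩ := exists_mem_notMem_of_card_lt_card (show t.card < s.card by omega)
      refine ⟨⟨a, ⟨has, fun h => hat (hσt h)⟩, ?_⟩, hσt.trans hts, hσc⟩
      refine (eq_of_subset_of_card_le (subset_erase.mpr ⟨hts, hat⟩) ?_).symm
      rw [card_erase_of_mem has]
      omega
    · rintro ⟨⟨a, ⟨has, haσ⟩, rfl⟩, hσs, hσc⟩
      refine ⟨⟨erase_subset _ _, ?_⟩, subset_erase.mpr ⟨hσs, haσ⟩, hσc⟩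
      rw [card_erase_of_mem has]
      omega

theorem choose_mul_Uc (X : WSC n d) (j : ℕ) (g : Cf n) (m : ℕ) :
    ∀ s ∈ X.faces (j + m),
      ((j + m).choose j : ℝ) * Uc X j m g s = ∑ σ ∈ powersetCard j s, g σ := by
  induction m with
  | zero =>
    intro s hs
    obtain rfl := X.card_mem _ s hs
    simp [Uc]
  | succ m ih =>
    intro s hs
    have hc := X.card_mem _ s hs
    have hsum := sum_sum_powersetCard_subsets g hc
    have hU : Uc X j (m + 1) g s =
        1 / ((j + m : ℕ) + 1 : ℝ) * ∑ t ∈ powersetCard (j + m) s, Uc X j m g t := by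
      rw [Uc, Uop, X.filter_faces_subset hs]
    have ht : ∀ t ∈ powersetCard (j + m) s,
        ∑ σ ∈ powersetCard j t, g σ = ((j + m).choose j : ℝ) * Uc X j m g t := by
      intro t ht
      rw [mem_powersetCard] at ht
      refine (ih t ?_).symm
      rw [← ht.2]
      exact X.mem_faces_of_subset hs ht.1
    rw [sum_congr rfl ht, ← mul_sum] at hsum
    have hch : ((j + (m + 1)).choose j : ℝ) * (m + 1) = (j + m).choose j * ((j + m : ℕ) + 1) := by
      have := Nat.choose_mul_succ_eq (j + m) j
      rw [show j + m + 1 - j = m + 1 by omega] at this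
      exact_mod_cast this.symm
    have hm : (m : ℝ) + 1 ≠ 0 := by positivity
    apply mul_left_cancel₀ hm
    rw [← hsum, hU, ← mul_assoc, mul_comm ((m : ℝ) + 1), hch]
    have : ((j + m : ℕ) : ℝ) + 1 ≠ 0 := by positivity
    field_simp

theorem gLevel_eq_altSum (X : WSC n d) {k : ℕ} (hk : k ≤ d) (f : Cf n) (i : ℕ) (hik : i ≤ k) :
    ∀ s ∈ X.faces i, gLevel X k f i s = altSum (fun T => linkMean X k T f) s := by
  induction i using Nat.strong_induction_on with
  | _ i ih =>
    intro s hs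
    have hc := X.card_mem i s hs
    have hD : Dc X k (k - i) f s = linkMean X k s f :=
      Dc_eq_linkMean X hk f (k - i) (by omega) s (by rwa [Nat.sub_sub_self hik])
    have hU : ∀ j ∈ range i, (i.choose j : ℝ) * Uc X j (i - j) (gLevel X k f j) s =
        ∑ σ ∈ powersetCard j s, altSum (fun T => linkMean X k T f) σ := by
      intro j hj
      rw [mem_range] at hj
      have h := choose_mul_Uc X j (gLevel X k f j) (i - j)
      rw [Nat.add_sub_cancel' hj.le] at h
      rw [h s hs]
      refine sum_congr rfl fun σ hσ => ih j hj (by omega) σ ?_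
      rw [mem_powersetCard] at hσ
      rw [← hσ.2]
      exact X.mem_faces_of_subset hs hσ.1
    have hmob := sum_powerset_altSum (fun T => linkMean X k T f) s
    rw [sum_powerset, hc, sum_range_succ, ← hc, powersetCard_self, sum_singleton, hc] at hmob
    rw [gLevel, Pi.sub_apply, Finset.sum_apply, hD]
    simp only [Pi.smul_apply, smul_eq_mul]
    rw [sum_attach (range i)
      (fun j => (i.choose j : ℝ) * Uc X j (i - j) (gLevel X k f j) s), sum_congr rfl hU]
    linarith

/-- level functions under restriction: for any weighted pure
simplicial complex, `f ∈ C_k`, `j ≤ i ≤ k` and `τ ∈ X(j)`, the restriction of the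
`i`-th Bottom-Up level function to the link `X_τ` satisfies, on every `(i−j)`-face `I`
of `X_τ`: `g_i|_τ(I) = Σ_{σ ⊆ τ} (−1)^{|σ|}·g_{i−j}^{(τ∖σ)}(I)`, where `g_ℓ^{(υ)}` is
the `ℓ`-th Bottom-Up level function of `f|_υ` computed within the link `X_υ`. -/
theorem stmt10 (n d : ℕ) (X : WSC n d) (k : ℕ) (hk : k ≤ d) (f : Cf n)
    (i j : ℕ) (hji : j ≤ i) (hik : i ≤ k) (τ : Finset (Fin n)) (hτ : τ ∈ X.faces j) :
    ∀ I : Finset (Fin n), Disjoint I τ → τ ∪ I ∈ X.faces i →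
      gLevel X k f i (τ ∪ I) =
        ∑ σ ∈ τ.powerset, (-1:ℝ)^(σ.card) * gLink X k f (τ \ σ) I := by
  intro I hI hface
  rw [gLevel_eq_altSum X hk f i hik _ hface, altSum_union _ hI]
  rfl
end
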